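/- Truncated mean limit for geometric lengths (Lemma 5): Let (p_n) be a sequence with p_n ∈ (0,1), and for each n let N^{(n)} be a Geometric(p_n) random variable on {1,2,…}. If E[N^{(n)}]/log₂ n → 1/α as n → ∞ for some α > 0, then for every γ ≥ 0, E[ N^{(n)} · 1{N^{(n)} ≥ γ·log₂ n} ] / log₂ n → (γ + 1/α)·e^{−αγ} as n → ∞. -/

import Mathlib

open MeasureTheory Filter

/-- The series for the tail mean of a geometric random variable: the terms `m ≥ k + 1` of
`∑ m (1 - p)^(m - 1) p` sum to `(k + 1/p) (1 - p)^k`. -/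
lemma hasSum_geometric_tail_mean {p : ℝ} (hp : p ∈ Set.Ioo (0 : ℝ) 1) (k : ℕ) :
    HasSum (fun j : ℕ => ((j + (k + 1) : ℕ) : ℝ) * ((1 - p) ^ (j + k) * p))
      ((k + p⁻¹) * (1 - p) ^ k) := by
  obtain ⟨hp0, hp1⟩ := hp
  have hq : ‖1 - p‖ < 1 := by rw [Real.norm_eq_abs, abs_lt]; constructor <;> linarith
  have h1 := (hasSum_coe_mul_geometric_of_norm_lt_one hq).mul_left ((1 - p) ^ k * p)
  have h2 := (hasSum_geometric_of_norm_lt_one hq).mul_left (((k : ℝ) + 1) * (1 - p) ^ k * p)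
  have hval : (k + p⁻¹) * (1 - p) ^ k = (1 - p) ^ k * p * ((1 - p) / (1 - (1 - p)) ^ 2) +
      (k + 1) * (1 - p) ^ k * p * (1 - (1 - p))⁻¹ := by
    rw [sub_sub_cancel]
    field_simp
    ring
  rw [hval]
  refine (h1.add h2).congr_fun fun j => ?_
  push_cast
  ring

/-- The same series over all of `ℕ`, with the truncation `t ≤ m` at a real level. -/
lemma hasSum_geometric_truncated_mean {p : ℝ} (hp : p ∈ Set.Ioo (0 : ℝ) 1) (t : ℝ) :
    HasSum (fun m : ℕ => (if t ≤ (m : ℝ) then (m : ℝ) else 0) * ((1 - p) ^ (m - 1) * p))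
      (((⌈t⌉₊ - 1 : ℕ) + p⁻¹) * (1 - p) ^ (⌈t⌉₊ - 1)) := by
  set k := ⌈t⌉₊ - 1 with hk
  have h := hasSum_geometric_tail_mean hp k
  rw [← hasSum_nat_add_iff' (k + 1), Finset.sum_eq_zero, sub_zero]
  · refine h.congr_fun fun j => ?_
    rw [if_pos (Nat.ceil_le.mp (by omega))]
    simp [← add_assoc]
  · intro m hm
    rw [Finset.mem_range] at hm
    rcases Nat.eq_zero_or_pos m with rfl | hm0
    · simp
    · rw [if_neg, zero_mul]
      intro hle
      have := Nat.ceil_le.mpr hle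
      omega

/-- The truncated mean of a geometric random variable on `{1, 2, …}`. -/
lemma integral_geometric_truncated {Ω : Type*} [MeasurableSpace Ω] {μ : Measure Ω}
    {N : Ω → ℕ} (hN : Measurable N) {p : ℝ} (hp : p ∈ Set.Ioo (0 : ℝ) 1)
    (hgeom : ∀ m, 1 ≤ m → μ {ω | N ω = m} = ENNReal.ofReal ((1 - p) ^ (m - 1) * p)) (t : ℝ) :
    ∫ ω, (if t ≤ (N ω : ℝ) then (N ω : ℝ) else 0) ∂μ =
      ((⌈t⌉₊ - 1 : ℕ) + p⁻¹) * (1 - p) ^ (⌈t⌉₊ - 1) := by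
  let f : ℕ → ℝ := fun m => if t ≤ (m : ℝ) then (m : ℝ) else 0
  have hf : ∀ m, 0 ≤ f m := fun m => by dsimp only [f]; positivity
  have hsum := hasSum_geometric_truncated_mean hp t
  have hw : ∀ m : ℕ, 0 ≤ (1 - p) ^ (m - 1) * p := fun m =>
    mul_nonneg (pow_nonneg (by linarith [hp.2]) _) hp.1.le
  have hfN : Measurable fun ω => f (N ω) := (measurable_of_countable f).comp hN
  change ∫ ω, f (N ω) ∂μ = _
  rw [integral_eq_lintegral_of_nonneg_ae (ae_of_all _ fun ω => hf (N ω))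
    hfN.aestronglyMeasurable,
    ← lintegral_map (f := fun m => ENNReal.ofReal (f m)) (measurable_of_countable _) hN,
    lintegral_countable']
  have hterm : ∀ m : ℕ, ENNReal.ofReal (f m) * μ.map N {m} =
      ENNReal.ofReal (f m * ((1 - p) ^ (m - 1) * p)) := by
    intro m
    rcases Nat.eq_zero_or_pos m with rfl | hm
    · simp [f]
    · rw [Measure.map_apply hN (measurableSet_singleton m), ENNReal.ofReal_mul (hf m),
        ← hgeom m hm]
      rfl
  simp_rw [hterm]
  rw [← ENNReal.ofReal_tsum_of_nonneg (fun m => mul_nonneg (hf m) (hw m)) hsum.summable,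
    hsum.tsum_eq, ENNReal.toReal_ofReal]
  exact hsum.nonneg fun m => mul_nonneg (hf m) (hw m)

/-- Asymptotics of the geometric tail mean at level `γ L` when `1/p ~ L/α` and `L → ∞`. -/
lemma tendsto_geometric_tail_mean {ι : Type*} {l : Filter ι} {p L : ι → ℝ}
    (hp : ∀ n, p n ∈ Set.Ioo (0 : ℝ) 1) {α : ℝ} (hα : 0 < α) (hL : Tendsto L l atTop)
    (hmean : Tendsto (fun n => (p n)⁻¹ / L n) l (nhds α⁻¹)) {γ : ℝ} (hγ : 0 ≤ γ) :
    Tendsto (fun n => ((⌈γ * L n⌉₊ - 1 : ℕ) + (p n)⁻¹) * (1 - p n) ^ (⌈γ * L n⌉₊ - 1) / L n) l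
      (nhds ((γ + α⁻¹) * Real.exp (-(α * γ)))) := by
  have hLpos : ∀ᶠ n in l, 0 < L n := hL.eventually_gt_atTop 0
  have hceil : Tendsto (fun n => (⌈γ * L n⌉₊ : ℝ) / L n) l (nhds γ) :=
    (tendsto_nat_ceil_mul_div_atTop hγ).comp hL
  have hinv : Tendsto (fun n => (L n)⁻¹) l (nhds 0) := tendsto_inv_atTop_zero.comp hL
  have hk : Tendsto (fun n => ((⌈γ * L n⌉₊ - 1 : ℕ) : ℝ) / L n) l (nhds γ) := by
    refine tendsto_of_tendsto_of_tendsto_of_le_of_le' (by simpa using hceil.sub hinv) hceil ?_ ?_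
    · filter_upwards [hLpos] with n hn
      rw [← one_div, ← sub_div]
      gcongr
      rw [sub_le_iff_le_add]
      exact_mod_cast (by omega : ⌈γ * L n⌉₊ ≤ ⌈γ * L n⌉₊ - 1 + 1)
    · filter_upwards [hLpos] with n hn
      gcongr
      omega
  have hpL : Tendsto (fun n => p n * L n) l (nhds α) := by
    simpa [div_eq_mul_inv, mul_comm] using hmean.inv₀ (inv_ne_zero hα.ne')
  have hp0 : Tendsto p l (nhds 0) := by
    have h := hpL.mul hinv
    rw [mul_zero] at h
    refine h.congr' ?_
    filter_upwards [hLpos] with n hn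
    field_simp
  have hlog : Tendsto (fun n => Real.log (1 - p n) / p n) l (nhds (-1)) := by
    have hd : HasDerivAt (fun x : ℝ => Real.log (1 - x)) (-1) 0 := by
      simpa using ((hasDerivAt_id (0 : ℝ)).const_sub 1).log (by simp)
    have hp0' : Tendsto p l (nhdsWithin 0 {0}ᶜ) :=
      tendsto_nhdsWithin_iff.mpr ⟨hp0, Eventually.of_forall fun n => (hp n).1.ne'⟩
    refine (hd.tendsto_slope_zero.comp hp0').congr fun n => ?_
    simp [div_eq_inv_mul]
  have hpow : Tendsto (fun n => (1 - p n) ^ (⌈γ * L n⌉₊ - 1)) l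
      (nhds (Real.exp (-(α * γ)))) := by
    have h := (Real.continuous_exp.tendsto _).comp ((hk.mul hpL).mul hlog)
    rw [show γ * α * -1 = -(α * γ) by ring] at h
    refine h.congr' ?_
    filter_upwards [hLpos] with n hn
    have hpn := (hp n).1
    have hq : 0 < 1 - p n := by linarith [(hp n).2]
    rw [← Real.exp_log (pow_pos hq _), Real.log_pow, Function.comp_apply]
    congr 1
    field_simp
  refine ((hk.add hmean).mul hpow).congr fun n => ?_
  ring

/-- Truncated mean limit for geometric lengths (Lemma 5): if `N^{(n)}` is `Geometric(p_n)`
on `{1,2,…}` (so `E[N^{(n)}] = 1/p_n`) and `E[N^{(n)}]/log₂ n → 1/α` for some `α > 0`,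
then for every `γ ≥ 0`,
`E[N^{(n)} · 1{N^{(n)} ≥ γ log₂ n}]/log₂ n → (γ + 1/α) e^{-αγ}` as `n → ∞`. -/
theorem geometric_truncated_mean_limit
    (p : ℕ → ℝ) (hp : ∀ n, p n ∈ Set.Ioo (0 : ℝ) 1) (α : ℝ) (hα : 0 < α)
    (Ω : ℕ → Type) [∀ n, MeasurableSpace (Ω n)]
    (μ : ∀ n, Measure (Ω n)) [∀ n, IsProbabilityMeasure (μ n)]
    (N : ∀ n, Ω n → ℕ) (hmeas : ∀ n, Measurable (N n))
    (hgeom : ∀ n m, 1 ≤ m →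
      μ n {ω | N n ω = m} = ENNReal.ofReal ((1 - p n) ^ (m - 1) * p n))
    (hmean : Tendsto (fun n => (p n)⁻¹ / Real.logb 2 n) atTop (nhds α⁻¹))
    (γ : ℝ) (hγ : 0 ≤ γ) :
    Tendsto
      (fun n =>
        (∫ ω, (if γ * Real.logb 2 n ≤ (N n ω : ℝ) then (N n ω : ℝ) else 0) ∂ μ n) /
          Real.logb 2 n)
      atTop (nhds ((γ + α⁻¹) * Real.exp (-(α * γ)))) := by
  have hL : Tendsto (fun n : ℕ => Real.logb 2 n) atTop atTop :=
    (Real.tendsto_logb_atTop one_lt_two).comp tendsto_natCast_atTop_atTop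
  simp_rw [fun n => integral_geometric_truncated (hmeas n) (hp n) (hgeom n) (γ * Real.logb 2 n)]
  exact tendsto_geometric_tail_mean hp hα hL hmean hγ
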